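/- arXiv:0707.1767 — 2 statements merged into one kernel-verified Lean document; each statement's English description precedes it below -/
import Mathlib

section
/- Assume in addition that s_j ≠ 0 for all j. Then φ(0, t) = ( ∏_{m=1}^N s_m ) · V_N · Σ_{j=1}^N ( ∏_{m≠j}(s_m − s_j) )^{−1} · t_j / s_j. Consequently the polynomial φ(·, t) has a zero at λ = 0 if and only if Σ_{j=1}^N ( ∏_{m≠j}(s_m − s_j) )^{−1} t_j / s_j = 0, i.e. if and only if [t] lies on the hyperplane Θ₀ of the paper. -/
open Polynomial in
theorem Matrix.det_updateCol_last_vandermonde {F : Type*} [Field F] {n : ℕ} (v b : Fin (n + 1) → F)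
    (hv : Function.Injective v) :
    ((Matrix.vandermonde v).updateCol (Fin.last n) b).det =
      (Matrix.vandermonde v).det *
        ∑ i, b i / ∏ j ∈ Finset.univ.erase i, (v i - v j) := by
  have hinj : Set.InjOn v (Finset.univ : Finset (Fin (n + 1))) := hv.injOn
  set P : F[X] := Lagrange.interpolate Finset.univ v b with hP
  have hdeg : P.degree < (Finset.univ : Finset (Fin (n + 1))).card :=
    Lagrange.degree_interpolate_lt b hinj
  have heval (i) : P.eval (v i) = b i :=
    Lagrange.eval_interpolate_at_node b hinj (Finset.mem_univ i)
  have hcoeff := Lagrange.coeff_eq_sum hinj hdeg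
  simp only [Finset.card_univ, Fintype.card_fin, Nat.add_sub_cancel, heval] at hcoeff hdeg
  have hnat : P.natDegree < n + 1 := by
    by_cases h0 : P = 0
    · simp [h0]
    · exact (natDegree_lt_iff_degree_lt h0).2 hdeg
  have hb : b = fun k ↦ ∑ i : Fin (n + 1), P.coeff i • Matrix.vandermonde v k i := by
    ext k
    rw [← heval k, eval_eq_sum_range' hnat, Finset.sum_range]
    simp [Matrix.vandermonde_apply]
  rw [← hcoeff]
  conv_lhs => rw [hb]
  rw [Matrix.det_updateCol_sum _ _ (fun i : Fin (n + 1) ↦ P.coeff i)]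
  simp [mul_comm]

/-- Assuming all s_j ≠ 0, one has
φ(0, t) = ( ∏_m s_m ) · V_N · Σ_j ( ∏_{m≠j}(s_m − s_j) )⁻¹ · t_j / s_j,
where φ(λ, t) is the determinant of the N×N matrix whose i-th row is
(1, s_i, …, s_i^{N−2}, t_i·∏_{m≠i}(λ − s_m)).  Consequently φ(·,t) has a zero at λ = 0
iff Σ_j ( ∏_{m≠j}(s_m − s_j) )⁻¹ t_j / s_j = 0 (the hyperplane Θ₀). -/
theorem stmt6 (N : ℕ) (hN : 2 ≤ N) (s : Fin N → ℂ) (hs : Function.Injective s)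
    (hs0 : ∀ j, s j ≠ 0)
    (t : Fin N → ℂ)
    (V : ℂ)
    (hV : V = ∏ q ∈ Finset.univ.filter (fun q : Fin N × Fin N => q.1 < q.2), (s q.2 - s q.1))
    (M : ℂ → Matrix (Fin N) (Fin N) ℂ)
    (hM : ∀ lam : ℂ, M lam = Matrix.of fun i j : Fin N =>
      if (j : ℕ) = N - 1 then t i * ∏ m ∈ Finset.univ.erase i, (lam - s m)
      else s i ^ (j : ℕ)) :
    (M 0).det = (∏ m : Fin N, s m) * V *
        ∑ j : Fin N, (∏ m ∈ Finset.univ.erase j, (s m - s j))⁻¹ * (t j / s j)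
    ∧ ((M 0).det = 0 ↔
        ∑ j : Fin N, (∏ m ∈ Finset.univ.erase j, (s m - s j))⁻¹ * (t j / s j) = 0) := by
  obtain ⟨n, rfl⟩ : ∃ n, N = n + 1 := ⟨N - 1, by omega⟩
  have hVdet : V = (Matrix.vandermonde s).det := by
    rw [hV, Matrix.det_vandermonde]
    exact Finset.prod_finset_product _ _ _ (by simp) (f := fun q ↦ s q.2 - s q.1)
  have hVne : V ≠ 0 := hVdet ▸ Matrix.det_vandermonde_ne_zero_iff.2 hs
  have hM0 : M 0 = (Matrix.vandermonde s).updateCol (Fin.last n)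
      (fun i ↦ t i * ∏ m ∈ Finset.univ.erase i, (0 - s m)) := by
    rw [hM]
    ext i j
    simp [Matrix.updateCol_apply, Matrix.vandermonde_apply, Fin.ext_iff]
  have hdet : (M 0).det = (∏ m, s m) * V *
      ∑ j, (∏ m ∈ Finset.univ.erase j, (s m - s j))⁻¹ * (t j / s j) := by
    rw [hM0, Matrix.det_updateCol_last_vandermonde _ _ hs, ← hVdet, mul_comm (∏ m, s m) V,
      mul_assoc, Finset.mul_sum _ _ (∏ m, s m)]
    congr 1
    refine Finset.sum_congr rfl fun i _ ↦ ?_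
    have hquot : (∏ m ∈ Finset.univ.erase i, (0 - s m)) / ∏ m ∈ Finset.univ.erase i, (s i - s m) =
        (∏ m ∈ Finset.univ.erase i, s m) / ∏ m ∈ Finset.univ.erase i, (s m - s i) := by
      rw [← Finset.prod_div_distrib, ← Finset.prod_div_distrib]
      refine Finset.prod_congr rfl fun m _ ↦ ?_
      rw [zero_sub, ← neg_sub (s m) (s i), neg_div_neg_eq]
    rw [mul_div_assoc, hquot, ← Finset.mul_prod_erase _ s (Finset.mem_univ i)]
    have := hs0 i
    field_simp
  refine ⟨hdet, ?_⟩
  rw [hdet, mul_eq_zero, or_iff_right]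
  exact mul_ne_zero (Finset.prod_ne_zero_iff.2 fun m _ ↦ hs0 m) hVne
end

section
/- For j = 1, …, 4 let I_j ⊆ S be the ideal generated by Z_j − p together with the variables Z_k for k ≠ j (1 ≤ k ≤ 4), and let I₅ be the ideal generated by Z₁, Z₂, Z₃, Z₄. Then I = I₁ ∩ I₂ ∩ I₃ ∩ I₄ ∩ I₅, and for each j = 1, …, 5 the quotient S/I_j is isomorphic as an R-algebra to R = ℂ[λ, λ⁻¹]. (This expresses that the affine spectral curve X₀ is reduced with exactly five irreducible components C₁, …, C₅, each a smooth rational curve.) -/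
namespace MvPolynomial

variable {R σ : Type*} [CommRing R]

theorem sub_C_aeval_mem {J : Ideal (MvPolynomial σ R)} {a : σ → R}
    (hJ : ∀ k, X k - C (a k) ∈ J) (f : MvPolynomial σ R) :
    f - C (aeval a f) ∈ J := by
  induction f using MvPolynomial.induction_on with
  | C r => simp
  | add f g hf hg =>
    rw [map_add, map_add, add_sub_add_comm]
    exact J.add_mem hf hg
  | mul_X f k hf =>
    have h : f * X k - C (aeval a (f * X k)) =
        X k * (f - C (aeval a f)) + C (aeval a f) * (X k - C (a k)) := by
      simp only [map_mul, aeval_X]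
      ring
    rw [h]
    exact J.add_mem (J.mul_mem_left _ hf) (J.mul_mem_left _ (hJ k))

/-- An ideal vanishing at `a` and containing every `X k - C (a k)` is the ideal of the
point `a`. -/
theorem eq_ker_aeval {J : Ideal (MvPolynomial σ R)} {a : σ → R}
    (hJ : ∀ k, X k - C (a k) ∈ J) (hle : J ≤ RingHom.ker (aeval (R := R) a)) :
    J = RingHom.ker (aeval (R := R) a) := by
  refine le_antisymm hle fun f hf => ?_
  have h := sub_C_aeval_mem hJ f
  rw [RingHom.mem_ker] at hf
  rwa [hf, map_zero, sub_zero] at h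

theorem aeval_surjective (a : σ → R) :
    Function.Surjective (aeval (R := R) a) := fun r => ⟨C r, by simp⟩

/-- The quotient by the ideal of an `R`-point is `R`. -/
theorem nonempty_quotient_algEquiv {J : Ideal (MvPolynomial σ R)} {a : σ → R}
    (h : J = RingHom.ker (aeval (R := R) a)) :
    Nonempty ((MvPolynomial σ R ⧸ J) ≃ₐ[R] R) := by
  subst h
  exact ⟨Ideal.quotientKerAlgEquivOfSurjective (aeval_surjective a)⟩

theorem span_X_sub_C_eq_ker [DecidableEq σ] (p : R) (j : σ) :
    Ideal.span ({X j - C p} ∪ {q : MvPolynomial σ R | ∃ k, k ≠ j ∧ q = X k}) =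
      RingHom.ker (aeval (R := R) (Pi.single j p : σ → R)) := by
  apply eq_ker_aeval
  · intro k
    apply Ideal.subset_span
    by_cases h : k = j
    · subst h
      simp
    · exact Or.inr ⟨k, h, by simp [h]⟩
  · rw [Ideal.span_le]
    rintro _ (rfl | ⟨k, hk, rfl⟩)
    · simp
    · simp [hk]

theorem span_X_eq_ker :
    Ideal.span {q : MvPolynomial σ R | ∃ k, q = X k} =
      RingHom.ker (aeval (R := R) (0 : σ → R)) := by
  apply eq_ker_aeval
  · exact fun k => Ideal.subset_span ⟨k, by simp⟩
  · rw [Ideal.span_le]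
    rintro _ ⟨k, rfl⟩
    simp

/-- Modulo the relations `X j * X k = 0` for `j ≠ k` and `X j ^ 2 = p * X j`, every polynomial
is affine-linear. -/
theorem exists_sub_affine_mem [Fintype σ] {J : Ideal (MvPolynomial σ R)} {p : R}
    (hmul : ∀ j k, j ≠ k → X j * X k ∈ J) (hsq : ∀ j, X j ^ 2 - C p * X j ∈ J)
    (f : MvPolynomial σ R) :
    ∃ (c : R) (b : σ → R), f - (C c + ∑ j, C (b j) * X j) ∈ J := by
  classical
  induction f using MvPolynomial.induction_on with
  | C r => exact ⟨r, 0, by simp⟩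
  | add f g hf hg =>
    obtain ⟨c, b, hf⟩ := hf
    obtain ⟨c', b', hg⟩ := hg
    refine ⟨c + c', b + b', ?_⟩
    convert J.add_mem hf hg using 1
    simp only [map_add, Pi.add_apply, add_mul, Finset.sum_add_distrib]
    ring
  | mul_X f i hf =>
    obtain ⟨c, b, hf⟩ := hf
    refine ⟨0, Pi.single i (c + b i * p), ?_⟩
    have hsum : ∑ j, C (b j) * (X j * X i - if j = i then C p * X i else 0) ∈ J := by
      refine J.sum_mem fun j _ => J.mul_mem_left _ ?_
      split_ifs with h
      · subst h
        rw [← sq]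
        exact hsq j
      · rw [sub_zero]
        exact hmul j i h
    have hsingle : ∑ j, C ((Pi.single i (c + b i * p) : σ → R) j) * X j =
        (C (c + b i * p) * X i : MvPolynomial σ R) := by
      rw [Finset.sum_eq_single i (fun j _ h => by simp [h]) (by simp), Pi.single_eq_same]
    have hexp : ∑ j, C (b j) * (X j * X i - if j = i then C p * X i else 0) =
        (∑ j, C (b j) * X j) * X i - C (b i) * (C p * X i) := by
      simp [mul_sub, Finset.sum_sub_distrib, Finset.sum_mul, mul_assoc]
    convert J.add_mem (J.mul_mem_left (X i) hf) hsum using 1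
    rw [hsingle, hexp, map_add, map_mul, map_zero]
    ring

/-- The relations `X j * X k = 0` for `j ≠ k` and `X j ^ 2 = p * X j` cut out the union of the
origin and the points `p • e j`. -/
theorem eq_iInf_ker_inf_ker [Fintype σ] [DecidableEq σ] [NoZeroDivisors R]
    {J : Ideal (MvPolynomial σ R)} {p : R} (hp : p ≠ 0)
    (hmul : ∀ j k, j ≠ k → X j * X k ∈ J) (hsq : ∀ j, X j ^ 2 - C p * X j ∈ J)
    (hle : J ≤ (⨅ j, RingHom.ker (aeval (R := R) (Pi.single j p : σ → R))) ⊓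
      RingHom.ker (aeval (R := R) (0 : σ → R))) :
    J = (⨅ j, RingHom.ker (aeval (R := R) (Pi.single j p : σ → R))) ⊓
      RingHom.ker (aeval (R := R) (0 : σ → R)) := by
  refine le_antisymm hle fun f hf => ?_
  obtain ⟨c, b, h⟩ := exists_sub_affine_mem hmul hsq f
  have h' := hle h
  simp only [Ideal.mem_inf, Ideal.mem_iInf, RingHom.mem_ker] at hf h'
  have hc : c = 0 := by
    have h0 := h'.2
    rw [map_sub, hf.2] at h0
    simpa using h0
  have hb : b = 0 := by
    funext j
    have hj := h'.1 j
    rw [map_sub, hf.1 j] at hj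
    simpa [hc, Pi.single_apply, hp] using hj
  simpa [hc, hb] using h

end MvPolynomial


/-- With R = ℂ[λ,λ⁻¹], S = R[Z₁,Z₂,Z₃,Z₄], I the ideal generated by the
Z_j·Z_k (j<k) and Z_j² − p·Z_j, and with I_j = (Z_j − p, Z_k (k ≠ j)) for j = 1,…,4 and
I₅ = (Z₁,Z₂,Z₃,Z₄), one has I = I₁ ∩ I₂ ∩ I₃ ∩ I₄ ∩ I₅ and each quotient S/I_j
(j = 1,…,5) is isomorphic as an R-algebra to R. -/
theorem stmt11 (p : LaurentPolynomial ℂ) (hp : p ≠ 0)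
    (I : Ideal (MvPolynomial (Fin 4) (LaurentPolynomial ℂ)))
    (hI : I = Ideal.span
      ({q | ∃ j k : Fin 4, j < k ∧ q = MvPolynomial.X j * MvPolynomial.X k} ∪
       {q | ∃ j : Fin 4, q = MvPolynomial.X j ^ 2 - MvPolynomial.C p * MvPolynomial.X j}))
    (Ij : Fin 4 → Ideal (MvPolynomial (Fin 4) (LaurentPolynomial ℂ)))
    (hIj : ∀ j : Fin 4, Ij j = Ideal.span
      ({MvPolynomial.X j - MvPolynomial.C p} ∪
       {q | ∃ k : Fin 4, k ≠ j ∧ q = MvPolynomial.X k}))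
    (I5 : Ideal (MvPolynomial (Fin 4) (LaurentPolynomial ℂ)))
    (hI5 : I5 = Ideal.span {q | ∃ k : Fin 4, q = MvPolynomial.X k}) :
    I = (⨅ j : Fin 4, Ij j) ⊓ I5
    ∧ (∀ j : Fin 4, Nonempty
        ((MvPolynomial (Fin 4) (LaurentPolynomial ℂ) ⧸ Ij j)
          ≃ₐ[LaurentPolynomial ℂ] LaurentPolynomial ℂ))
    ∧ Nonempty
        ((MvPolynomial (Fin 4) (LaurentPolynomial ℂ) ⧸ I5)
          ≃ₐ[LaurentPolynomial ℂ] LaurentPolynomial ℂ) := by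
  obtain rfl : Ij = fun j => RingHom.ker (MvPolynomial.aeval (R := LaurentPolynomial ℂ)
      (Pi.single j p : Fin 4 → LaurentPolynomial ℂ)) :=
    funext fun j => (hIj j).trans (MvPolynomial.span_X_sub_C_eq_ker p j)
  rw [MvPolynomial.span_X_eq_ker] at hI5
  refine ⟨?_, fun j => MvPolynomial.nonempty_quotient_algEquiv rfl,
    MvPolynomial.nonempty_quotient_algEquiv hI5⟩
  subst hI hI5
  apply MvPolynomial.eq_iInf_ker_inf_ker hp
  · intro j k hjk
    apply Ideal.subset_span
    rcases hjk.lt_or_gt with h | h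
    · exact Or.inl ⟨j, k, h, rfl⟩
    · exact Or.inl ⟨k, j, h, mul_comm _ _⟩
  · exact fun j => Ideal.subset_span (Or.inr ⟨j, rfl⟩)
  · rw [Ideal.span_le]
    rintro _ (⟨j, k, hjk, rfl⟩ | ⟨j, rfl⟩)
    · simp only [SetLike.mem_coe, Ideal.mem_inf, Ideal.mem_iInf, RingHom.mem_ker, map_mul,
        MvPolynomial.aeval_X, Pi.zero_apply, mul_zero, and_true]
      intro i
      rcases eq_or_ne j i with rfl | h
      · simp [hjk.ne']
      · simp [h]
    · simp only [SetLike.mem_coe, Ideal.mem_inf, Ideal.mem_iInf, RingHom.mem_ker]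
      refine ⟨fun i => ?_, by simp⟩
      rcases eq_or_ne j i with rfl | h
      · simp [sq]
      · simp [h]
end
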